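/- arXiv:1812.00314 — 4 statements merged into one kernel-verified Lean document; each statement's English description precedes it below -/
import Mathlib

section
/- Let T : Fin 4 → Fin 4 → Fin 4 → ℝ be antisymmetric in its first two arguments (T i j k = −T j i k for all i, j, k), and define its trace t i := ∑_{l} T i l l. If for all indices i, j, k one has T i j k + (if k = i then t j else 0) − (if k = j then t i else 0) = 0, then T is identically zero. (Hence, in Einstein–Cartan theory, vanishing spin current of matter forces the torsion tensor to vanish, so the theory reduces to general relativity.) -/
/-- In Einstein–Cartan theory, if the torsion tensor `T` (antisymmetric in its first two
indices) satisfies the second Sciama–Kibble equation with vanishing spin current,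
`T i j k + δ_{k i} t j − δ_{k j} t i = 0` where `t i = ∑ l, T i l l`,
then the torsion tensor vanishes identically (the theory reduces to GR). -/
theorem torsion_vanishes_of_zero_spin_current
    (T : Fin 4 → Fin 4 → Fin 4 → ℝ)
    (hanti : ∀ i j k, T i j k = - T j i k)
    (hfield : ∀ i j k,
      T i j k + (if k = i then (∑ l, T j l l) else 0)
              - (if k = j then (∑ l, T i l l) else 0) = 0) :
    ∀ i j k, T i j k = 0 := by
  have trace_eq_zero : ∀ i, ∑ l, T i l l = 0 := by
    intro i
    have hsum := Finset.sum_eq_zero fun j (_ : j ∈ Finset.univ) => hfield i j j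
    simp only [Finset.sum_sub_distrib, Finset.sum_add_distrib, Finset.sum_ite_eq',
      Finset.mem_univ, if_true, Finset.sum_const, Finset.card_univ, Fintype.card_fin,
      nsmul_eq_mul] at hsum
    push_cast at hsum
    linarith
  intro i j k
  simpa [trace_eq_zero] using hfield i j k
end

section
/- With the η-basis of the exterior algebra of ℝ⁴ as defined in the context, let R : Fin 4 → Fin 4 → Fin 4 → Fin 4 → ℝ be antisymmetric in its last two arguments (R α β μ ν = −R α β ν μ). Then ∑_{α,β} ((1/2)·∑_{μ,ν} R α β μ ν • (e_μ ∧ e_ν)) ∧ η_{αβ} = (∑_{α,β} R α β α β) • η. (This is the component identity Ω^{αβ} ∧ η_{αβ} = R·η showing that the Einstein–Cartan Lagrangian (1/2κ) Ω^{αβ} ∧ η_{αβ} equals the Hilbert–Einstein Lagrangian (1/2κ) R √(−g) d⁴x.) -/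
noncomputable section

/-- Degree-one generators of the exterior algebra of ℝ⁴: images of the standard basis. -/
def e (α : Fin 4) : ExteriorAlgebra ℝ (Fin 4 → ℝ) :=
  ExteriorAlgebra.ι ℝ (Pi.single α 1)

/-- The dual basis `ε^α`. -/
def εdual (α : Fin 4) : Module.Dual ℝ (Fin 4 → ℝ) := LinearMap.proj α

/-- The volume form `η = e₀ ∧ e₁ ∧ e₂ ∧ e₃`. -/
def ηvol : ExteriorAlgebra ℝ (Fin 4 → ℝ) := e 0 * e 1 * e 2 * e 3

/-- `η_α := ι_{ε^α} η` (left contraction / interior product). -/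
def η₁ (α : Fin 4) : ExteriorAlgebra ℝ (Fin 4 → ℝ) :=
  CliffordAlgebra.contractLeft (εdual α) ηvol

/-- `η_{αβ} := ι_{ε^β} η_α`. -/
def η₂ (α β : Fin 4) : ExteriorAlgebra ℝ (Fin 4 → ℝ) :=
  CliffordAlgebra.contractLeft (εdual β) (η₁ α)

/-- `η_{αβγ} := ι_{ε^γ} η_{αβ}`. -/
def η₃ (α β γ : Fin 4) : ExteriorAlgebra ℝ (Fin 4 → ℝ) :=
  CliffordAlgebra.contractLeft (εdual γ) (η₂ α β)

/-- `η_{αβγδ} := ι_{ε^δ} η_{αβγ}`. -/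
def η₄ (α β γ δ : Fin 4) : ExteriorAlgebra ℝ (Fin 4 → ℝ) :=
  CliffordAlgebra.contractLeft (εdual δ) (η₃ α β γ)


/-- Left multiplication by a generator and contraction with a dual basis vector satisfy the
canonical anticommutation relation. -/
theorem e_mul_contractLeft (ν β : Fin 4) (x : ExteriorAlgebra ℝ (Fin 4 → ℝ)) :
    e ν * CliffordAlgebra.contractLeft (εdual β) x =
      (if ν = β then (1 : ℝ) else 0) • x - CliffordAlgebra.contractLeft (εdual β) (e ν * x) := by
  have h : CliffordAlgebra.contractLeft (εdual β) (e ν * x) =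
      εdual β (Pi.single ν 1) • x - e ν * CliffordAlgebra.contractLeft (εdual β) x :=
    CliffordAlgebra.contractLeft_ι_mul _ _ _
  rw [h, εdual, LinearMap.proj_apply, Pi.single_apply]
  simp [eq_comm]

/-- The volume form has top degree. -/
theorem e_mul_ηvol (ν : Fin 4) : e ν * ηvol = 0 := by
  have h : e ν * ηvol = ExteriorAlgebra.ιMulti ℝ 5
      (fun i => Pi.single ((![ν, 0, 1, 2, 3] : Fin 5 → Fin 4) i) (1 : ℝ)) := by
    simp [ExteriorAlgebra.ιMulti_apply, ηvol, e, mul_assoc]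
    rfl
  rw [h]
  refine AlternatingMap.map_eq_zero_of_eq _ _ (i := 0) (j := ν.succ) ?_ (Fin.succ_ne_zero ν).symm
  fin_cases ν <;> rfl

theorem e_mul_η₁ (ν α : Fin 4) : e ν * η₁ α = (if ν = α then (1 : ℝ) else 0) • ηvol := by
  rw [η₁, e_mul_contractLeft, e_mul_ηvol, map_zero, sub_zero]

theorem e_mul_e_mul_η₂ (μ ν α β : Fin 4) :
    e μ * e ν * η₂ α β =
      ((if ν = β then (1 : ℝ) else 0) * (if μ = α then 1 else 0) -
        (if ν = α then 1 else 0) * (if μ = β then 1 else 0)) • ηvol := by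
  have h : e μ * CliffordAlgebra.contractLeft (εdual β) ηvol =
      (if μ = β then (1 : ℝ) else 0) • ηvol := e_mul_η₁ μ β
  rw [mul_assoc, η₂, e_mul_contractLeft, e_mul_η₁, map_smul, mul_sub, mul_smul_comm,
    mul_smul_comm, e_mul_η₁, h, smul_smul, smul_smul, sub_smul]

/-- The component identity `Ω^{αβ} ∧ η_{αβ} = R · η`: for curvature coefficients
`R α β μ ν` antisymmetric in the last two indices, with curvature 2-forms
`Ω^{αβ} = (1/2) ∑ R α β μ ν (ϑ^μ ∧ ϑ^ν)`, one has
`∑_{α,β} Ω^{αβ} ∧ η_{αβ} = (∑_{α,β} R α β α β) • η`.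
Hence the Einstein–Cartan Lagrangian `(1/2κ) Ω^{αβ} ∧ η_{αβ}` equals the
Hilbert–Einstein Lagrangian `(1/2κ) R √(−g) d⁴x`. -/
theorem curvature_wedge_eta_eq_scalar (R : Fin 4 → Fin 4 → Fin 4 → Fin 4 → ℝ)
    (hR : ∀ α β μ ν, R α β μ ν = - R α β ν μ) :
    (∑ α : Fin 4, ∑ β : Fin 4,
        ((1 / 2 : ℝ) • ∑ μ : Fin 4, ∑ ν : Fin 4, R α β μ ν • (e μ * e ν)) * η₂ α β)
      = (∑ α : Fin 4, ∑ β : Fin 4, R α β α β) • ηvol := by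
  simp_rw [Finset.sum_smul]
  refine Finset.sum_congr rfl fun α _ => Finset.sum_congr rfl fun β _ => ?_
  simp_rw [smul_mul_assoc, Finset.sum_mul, smul_mul_assoc, e_mul_e_mul_η₂, smul_smul,
    ← Finset.sum_smul, smul_smul]
  congr 1
  simp [mul_sub, Finset.sum_sub_distrib]
  linarith [hR α β β α]

end
end

section
/- Let a₀, a₁, b ∈ ℝ with a₁ ≠ 0 and b ≠ 0, and set μ := a₀ + a₁. Let H, Φ, R : ℝ → ℝ be differentiable and 𝒯 : ℝ → ℝ arbitrary, satisfying for every t: H′ = (μ/(6a₁))·R + 𝒯/(6a₁) − 2H², Φ′ = (a₀/(2a₁))·R + 𝒯/(2a₁) − 3HΦ + Φ²/3, and R′ = −(2/3)·(R + 6μ/b)·Φ. Define ρ_T := 3μH² − (b/18)·(R + 6μ/b)·(3H − Φ)² + bR²/24, R̄ := 6(H′ + 2H²), and p_T := (μ(R − R̄) + ρ_T)/3. Then the torsion continuity equation ρ_T′ + 3H(ρ_T + p_T) = 0 holds at every t. -/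
/-- Continuity equation for the torsion dark energy in the SNY scalar-torsion mode:
if `H`, `Φ`, `R` satisfy the field equations of the spin-0⁺ mode with matter trace `𝒯`,
then the effective torsion density `ρ_T` and pressure `p_T` satisfy
`ρ_T' + 3H(ρ_T + p_T) = 0`. -/
theorem torsion_continuity_equation
    (a₀ a₁ b : ℝ) (ha₁ : a₁ ≠ 0) (hb : b ≠ 0)
    (μ : ℝ) (hμ : μ = a₀ + a₁)
    (H Φ R 𝒯 : ℝ → ℝ)
    (hH : Differentiable ℝ H) (hΦ : Differentiable ℝ Φ) (hR : Differentiable ℝ R)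
    (eq1 : ∀ t, deriv H t = μ / (6 * a₁) * R t + 𝒯 t / (6 * a₁) - 2 * H t ^ 2)
    (eq2 : ∀ t, deriv Φ t = a₀ / (2 * a₁) * R t + 𝒯 t / (2 * a₁)
        - 3 * H t * Φ t + Φ t ^ 2 / 3)
    (eq3 : ∀ t, deriv R t = -(2 / 3) * (R t + 6 * μ / b) * Φ t)
    (ρT Rbar pT : ℝ → ℝ)
    (hρT : ∀ t, ρT t = 3 * μ * H t ^ 2
        - b / 18 * (R t + 6 * μ / b) * (3 * H t - Φ t) ^ 2 + b * R t ^ 2 / 24)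
    (hRbar : ∀ t, Rbar t = 6 * (deriv H t + 2 * H t ^ 2))
    (hpT : ∀ t, pT t = (μ * (R t - Rbar t) + ρT t) / 3) :
    ∀ t, deriv ρT t + 3 * H t * (ρT t + pT t) = 0 := by
  intro t
  have hYd : deriv Φ t = 3 * deriv H t + 6 * H t ^ 2 - R t / 2
      - 3 * H t * Φ t + Φ t ^ 2 / 3 := by
    rw [eq1, eq2, hμ]
    field_simp
    ring
  have dH := (hH t).hasDerivAt
  have dΦ := (hΦ t).hasDerivAt
  have dR := (hR t).hasDerivAt
  have dρ := (((dH.pow 2).const_mul (3 * μ)).sub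
    (((dR.add_const (6 * μ / b)).const_mul (b / 18)).mul
      (((dH.const_mul 3).sub dΦ).pow 2))).add
    (((dR.pow 2).const_mul b).div_const 24)
  have hderiv := (dρ.congr_of_eventuallyEq (Filter.Eventually.of_forall hρT)).deriv
  rw [hderiv, hpT, hRbar, hρT, hYd, eq3]
  simp only [Pi.sub_apply, Pi.pow_apply]
  field_simp
  ring
end

section
/- Let ã₀, ã₁ > 0 with μ̃ := ã₁ − ã₀ ≠ 0 and χ ≥ 0. For a > 0 define F(a) := (ã₀/ã₁)·(a⁻³ + χ·a⁻⁴) + μ̃²/(2ã₁) and the torsion equation of state w_T(a) := −1 − (2/3)·a·F′(a)/(2F(a) − μ̃). Then: (i) if χ > 0, w_T(a) → 1/3 as a → 0⁺ (radiation-dominant behaviour); (ii) if χ = 0, w_T(a) → 0 as a → 0⁺ (matter-dominant behaviour); (iii) w_T(a) → −1 as a → ∞ (late-time de Sitter behaviour). -/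
open Filter

/-- Continuity of a quotient at a point where the denominator does not vanish, along a filter. -/
lemma tendsto_neg_one_add_div {l : Filter ℝ} {x p q : ℝ} {f g h : ℝ → ℝ}
    (hg : Continuous g) (hh : Continuous h) (hl : Tendsto f l (nhds x))
    (hp : g x = p) (hq : h x = q) (hq0 : q ≠ 0) :
    Tendsto (fun a => -1 + g (f a) / h (f a)) l (nhds (-1 + p / q)) := by
  subst hp hq
  exact (((hg.tendsto x).comp hl).div ((hh.tendsto x).comp hl) hq0).const_add (-1)

lemma hasDerivAt_matter_radiation (c χ e : ℝ) {a : ℝ} (ha : a ≠ 0) :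
    HasDerivAt (fun a : ℝ => c * (a ^ (-3 : ℤ) + χ * a ^ (-4 : ℤ)) + e)
      (c * (-3 * a ^ (-4 : ℤ) + χ * (-4 * a ^ (-5 : ℤ)))) a := by
  have h3 := hasDerivAt_zpow (-3) a (Or.inl ha)
  have h4 := hasDerivAt_zpow (-4) a (Or.inl ha)
  norm_num at h3 h4
  simpa using ((h3.add (h4.const_mul χ)).const_mul c).add_const e

/-- Asymptotic behaviour of the torsion equation of state in the constant-curvature
special case: with `F(a) = H̃²(a) = (ã₀/ã₁)(a⁻³ + χ a⁻⁴) + μ̃²/(2ã₁)` and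
`w_T(a) = −1 − (2/3) a F′(a)/(2F(a) − μ̃)`, one has
(i) `w_T → 1/3` as `a → 0⁺` if `χ > 0` (radiation-dominant behaviour),
(ii) `w_T → 0` as `a → 0⁺` if `χ = 0` (matter-dominant behaviour),
(iii) `w_T → −1` as `a → ∞` (late-time de Sitter behaviour). -/
theorem torsion_eos_asymptotics
    (a₀' a₁' χ : ℝ) (ha₀ : 0 < a₀') (ha₁ : 0 < a₁') (hχ : 0 ≤ χ)
    (μ' : ℝ) (hμdef : μ' = a₁' - a₀') (hμ : μ' ≠ 0)
    (F wT : ℝ → ℝ)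
    (hF : ∀ a, F a = a₀' / a₁' * (a ^ (-3 : ℤ) + χ * a ^ (-4 : ℤ)) + μ' ^ 2 / (2 * a₁'))
    (hw : ∀ a, wT a = -1 - 2 / 3 * a * deriv F a / (2 * F a - μ')) :
    (0 < χ → Tendsto wT (nhdsWithin 0 (Set.Ioi 0)) (nhds (1 / 3))) ∧
    (χ = 0 → Tendsto wT (nhdsWithin 0 (Set.Ioi 0)) (nhds 0)) ∧
    Tendsto wT atTop (nhds (-1)) := by
  obtain rfl : F = _ := funext hF
  set c := a₀' / a₁' with hc
  have hc0 : 0 < c := div_pos ha₀ ha₁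
  obtain ⟨d, hd⟩ : ∃ d, d = 2 * (μ' ^ 2 / (2 * a₁')) - μ' := ⟨_, rfl⟩
  have hd0 : d ≠ 0 := by
    have : d = -(μ' * c) := by
      rw [hd, hc]
      field_simp
      rw [hμdef]
      ring
    rw [this]
    exact neg_ne_zero.mpr (mul_ne_zero hμ hc0.ne')
  have key : ∀ a : ℝ, a ≠ 0 → wT a = -1 +
      (2 / 3 * c * (3 * a⁻¹ ^ 3 + 4 * χ * a⁻¹ ^ 4)) /
        (2 * c * (a⁻¹ ^ 3 + χ * a⁻¹ ^ 4) + d) := by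
    intro a ha
    rw [hw, (hasDerivAt_matter_radiation c χ _ ha).deriv, sub_eq_add_neg, ← neg_div, hd]
    congr 2
    · simp only [zpow_neg]
      field_simp
      ring
    · simp only [zpow_neg, inv_pow]
      norm_cast
      ring
  have hid : Tendsto (fun a : ℝ => a) (nhdsWithin 0 (Set.Ioi 0)) (nhds 0) :=
    tendsto_nhdsWithin_of_tendsto_nhds tendsto_id
  refine ⟨fun hχ0 => ?_, fun hχ0 => ?_, ?_⟩
  · have hlim := tendsto_neg_one_add_div
      (g := fun a => 2 / 3 * c * (3 * a + 4 * χ))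
      (h := fun a => 2 * c * (a + χ) + d * a ^ 4) (p := 2 / 3 * c * (4 * χ)) (q := 2 * c * χ)
      (by fun_prop) (by fun_prop) hid (by simp) (by simp) (by positivity)
    have hval : -1 + 2 / 3 * c * (4 * χ) / (2 * c * χ) = 1 / 3 := by
      field_simp
      norm_num
    rw [hval] at hlim
    refine hlim.congr' ?_
    filter_upwards [self_mem_nhdsWithin] with a (ha : 0 < a)
    rw [key a ha.ne', ← mul_div_mul_right _ (2 * c * (a⁻¹ ^ 3 + χ * a⁻¹ ^ 4) + d)
      (pow_ne_zero 4 ha.ne')]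
    congr 2 <;> field_simp
  · subst hχ0
    have hlim := tendsto_neg_one_add_div
      (g := fun _ => 2 * c) (h := fun a => 2 * c + d * a ^ 3) (p := 2 * c) (q := 2 * c)
      (by fun_prop) (by fun_prop) hid rfl (by simp) (by positivity)
    rw [div_self (by positivity), neg_add_cancel] at hlim
    refine hlim.congr' ?_
    filter_upwards [self_mem_nhdsWithin] with a (ha : 0 < a)
    rw [key a ha.ne', ← mul_div_mul_right _ (2 * c * (a⁻¹ ^ 3 + 0 * a⁻¹ ^ 4) + d)
      (pow_ne_zero 3 ha.ne')]
    congr 2 <;> field_simp <;> ring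
  · have hlim := tendsto_neg_one_add_div
      (g := fun u => 2 / 3 * c * (3 * u ^ 3 + 4 * χ * u ^ 4))
      (h := fun u => 2 * c * (u ^ 3 + χ * u ^ 4) + d) (p := 0) (q := d)
      (by fun_prop) (by fun_prop) (tendsto_inv_atTop_zero (𝕜 := ℝ)) (by simp) (by simp) hd0
    rw [zero_div, add_zero] at hlim
    refine hlim.congr' ?_
    filter_upwards [eventually_ne_atTop 0] with a ha
    exact (key a ha).symm
end
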